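/- Let G = GL(n, q) be the group of invertible n×n matrices over a finite field with q elements, n ≥ 2, and let A, B ∈ G. Then either (i) at least one of A, B is a scalar matrix and A^G · B^G = (AB)^G, or (ii) A^G · B^G is a union of at least q − 1 distinct conjugacy classes of G. -/

import Mathlib

open Pointwise

/-- Two linearly independent families of vectors with the same finite index type are related by a
linear automorphism of the ambient space. -/
theorem LinearIndependent.exists_linearEquiv_apply_eq {ι K V : Type*} [Finite ι] [Field K]
    [AddCommGroup V] [Module K V] {v w : ι → V} (hv : LinearIndependent K v)
    (hw : LinearIndependent K w) : ∃ e : V ≃ₗ[K] V, ∀ i, e (v i) = w i := by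
  have := FiniteDimensional.span_of_finite K (Set.finite_range v)
  obtain ⟨e, he⟩ := Submodule.exists_linearEquiv_restrict_eq
    (hv.linearCombinationEquiv.symm.trans hw.linearCombinationEquiv)
  refine ⟨e, fun i => ?_⟩
  have hi : hv.linearCombinationEquiv (Finsupp.single i 1) =
      ⟨v i, Submodule.subset_span ⟨i, rfl⟩⟩ := Subtype.ext (by simp)
  have := he ⟨v i, Submodule.subset_span ⟨i, rfl⟩⟩
  rw [← this, LinearEquiv.trans_apply, ← hi, LinearEquiv.symm_apply_apply]
  simp

section

variable {K V : Type*} [Field K] [AddCommGroup V] [Module K V]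

theorem exists_dual_ne_zero_of_notMem_span (s : Set V) {x : V} (hx : x ∉ Submodule.span K s) :
    ∃ f : Module.Dual K V, f x ≠ 0 ∧ ∀ y ∈ s, f y = 0 := by
  obtain ⟨f, hfx, hf⟩ := Submodule.exists_dual_map_eq_bot_of_notMem hx inferInstance
  refine ⟨f, hfx, fun y hy => ?_⟩
  have : f y ∈ (Submodule.span K s).map f := ⟨y, Submodule.subset_span hy, rfl⟩
  simpa [hf] using this

/-- If `f` kills `v` and `a v` but not `[b, a] v`, then conjugating `b` by the transvections along
`f` and `v` makes the trace of the product with `a` take every value. -/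
theorem exists_conj_trace_mul_eq [FiniteDimensional K V] (a b : Module.End K V)
    (f : Module.Dual K V) (v : V) (hfv : f v = 0) (hfa : f (a v) = 0)
    (hf : f (b (a v)) ≠ f (a (b v))) (τ : K) :
    ∃ e : V ≃ₗ[K] V, LinearMap.trace K V (a * e.conj b) = τ := by
  set c := f (b (a v)) - f (a (b v)) with hc
  have hc0 : c ≠ 0 := sub_ne_zero.2 hf
  set x := (τ - LinearMap.trace K V (a * b)) / c with hx
  have hxv : f (x • v) = 0 := by simp [hfv]
  refine ⟨LinearEquiv.transvection hxv, ?_⟩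
  have hsymm (u) : (LinearEquiv.transvection hxv).symm u = u - f u • x • v := by
    rw [LinearEquiv.symm_apply_eq]
    simp [LinearMap.transvection.apply, hfv]
  have key : a * (LinearEquiv.transvection hxv).conj b = a * b
      + x • (a * (f.smulRight v * b)) - x • (a * b * f.smulRight v)
      - (x * x) • f.smulRight (f (b v) • a v) := by
    ext u
    simp [LinearEquiv.conj_apply, hsymm, LinearMap.transvection.apply]
    module
  have h1 : LinearMap.trace K V (a * (f.smulRight v * b)) = f (b (a v)) := by
    rw [← mul_assoc, LinearMap.trace_mul_comm, ← mul_assoc,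
      show b * a * f.smulRight v = f.smulRight (b (a v)) by ext; simp, LinearMap.trace_smulRight]
  have h2 : LinearMap.trace K V (a * b * f.smulRight v) = f (a (b v)) := by
    rw [show a * b * f.smulRight v = f.smulRight (a (b v)) by ext; simp,
      LinearMap.trace_smulRight]
  rw [key]
  simp only [map_add, map_sub, map_smul, h1, h2, LinearMap.trace_smulRight, hfa, smul_eq_mul,
    mul_zero, sub_zero]
  rw [add_sub_assoc, ← mul_sub, ← hc, hx, div_mul_cancel₀ _ hc0, add_sub_cancel]

theorem exists_conj_trace_mul_eq_of_three_le_finrank [FiniteDimensional K V]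
    (hV : 3 ≤ Module.finrank K V) (a b : Module.End K V) {v w : V}
    (hv : LinearIndependent K ![v, a v]) (hw : LinearIndependent K ![w, b w]) (τ : K) :
    ∃ e : V ≃ₗ[K] V, LinearMap.trace K V (a * e.conj b) = τ := by
  classical
  obtain ⟨y, hy⟩ : ∃ y, y ∉ Submodule.span K {v, a v} := by
    by_contra! h
    have h1 : Submodule.span K {v, a v} = ⊤ := eq_top_iff.2 fun y _ => h y
    have h2 := finrank_span_le_card (R := K) ({v, a v} : Set V)
    rw [h1, finrank_top] at h2
    have h3 := Finset.card_le_two (a := v) (b := a v)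
    simp only [Set.toFinset_insert, Set.toFinset_singleton] at h2
    omega
  have hv0 : v ≠ 0 := hv.ne_zero 0
  have hvy : LinearIndependent K ![v, y] := by
    rw [LinearIndependent.pair_iff' hv0]
    rintro c rfl
    exact hy (Submodule.smul_mem _ _ (Submodule.subset_span (by simp)))
  obtain ⟨e, he⟩ := hw.exists_linearEquiv_apply_eq hvy
  have he0 : e w = v := he 0
  have he1 : e (b w) = y := he 1
  have hbv : e.conj b v = y := by simp [LinearEquiv.conj_apply, ← he0, he1]
  obtain ⟨f, hfy, hf⟩ := exists_dual_ne_zero_of_notMem_span _ hy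
  have hfv : f v = 0 := hf _ (by simp)
  have hfa : f (a v) = 0 := hf _ (by simp)
  have hav : a v ∉ Submodule.span K {v} := by
    rw [Submodule.mem_span_singleton]
    rintro ⟨c, hc⟩
    exact (LinearIndependent.pair_iff' hv0).1 hv c hc
  obtain ⟨g, hga, hg⟩ := exists_dual_ne_zero_of_notMem_span _ hav
  have hgv : g v = 0 := hg _ (by simp)
  by_cases h : f (e.conj b (a v)) = f (a (e.conj b v))
  · set t : V ≃ₗ[K] V := LinearEquiv.transvection hgv
    have ht (u) : t u = u + g u • v := rfl
    have hts (u) : t.symm u = u - g u • v := by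
      rw [LinearEquiv.symm_apply_eq, ht]; simp [hgv]
    obtain ⟨e', he'⟩ := exists_conj_trace_mul_eq a (t.conj (e.conj b)) f v hfv hfa (by
      simp only [LinearEquiv.conj_apply_apply t, hts, ht, map_sub, map_smul, map_add, hgv, hbv, hfv,
        hfa, h, smul_eq_mul]
      simpa [hfy] using hga) τ
    refine ⟨(e.trans t).trans e', ?_⟩
    rw [← he', ← LinearEquiv.conj_trans, ← LinearEquiv.conj_trans]
    rfl
  · obtain ⟨e', he'⟩ := exists_conj_trace_mul_eq a (e.conj b) f v hfv hfa h τ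
    refine ⟨e.trans e', ?_⟩
    rw [← he', ← LinearEquiv.conj_trans]
    rfl

theorem LinearMap.trace_mul_of_finrank_eq_two (hV : Module.finrank K V = 2) (a b : Module.End K V)
    {v : V} (hv : LinearIndependent K ![v, a v]) {α β : K} (hβ : β ≠ 0)
    (hb : b v = α • v + β • a v) :
    LinearMap.trace K V (a * b) = -LinearMap.det a * β
      + (α * (LinearMap.trace K V b - α) - LinearMap.det b) / β
      + LinearMap.trace K V a * (LinearMap.trace K V b - α) := by
  let B := basisOfLinearIndependentOfCardEqFinrank hv (by simp [hV])
  have hB0 : B 0 = v := by simp [B]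
  have hB1 : B 1 = a v := by simp [B]
  have ha00 : LinearMap.toMatrix B B a 0 0 = 0 := by
    rw [LinearMap.toMatrix_apply, hB0, ← hB1]; simp
  have ha10 : LinearMap.toMatrix B B a 1 0 = 1 := by
    rw [LinearMap.toMatrix_apply, hB0, ← hB1]; simp
  have hb00 : LinearMap.toMatrix B B b 0 0 = α := by
    rw [LinearMap.toMatrix_apply, hB0, hb, ← hB1, ← hB0]; simp
  have hb10 : LinearMap.toMatrix B B b 1 0 = β := by
    rw [LinearMap.toMatrix_apply, hB0, hb, ← hB1, ← hB0]; simp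
  rw [← LinearMap.det_toMatrix B, ← LinearMap.det_toMatrix B]
  simp only [LinearMap.trace_eq_matrix_trace K B, LinearMap.toMatrix_mul, Matrix.det_fin_two,
    Matrix.trace_fin_two, Matrix.mul_apply, Fin.sum_univ_two, ha00, ha10, hb00, hb10]
  field_simp
  ring

theorem exists_conj_trace_mul_eq_of_finrank_eq_two (hV : Module.finrank K V = 2)
    (a b : Module.End K V) {v w : V}
    (hv : LinearIndependent K ![v, a v]) (hw : LinearIndependent K ![w, b w])
    (α : K) {β : K} (hβ : β ≠ 0) :
    ∃ e : V ≃ₗ[K] V, LinearMap.trace K V (a * e.conj b) = -LinearMap.det a * β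
      + (α * (LinearMap.trace K V b - α) - LinearMap.det b) / β
      + LinearMap.trace K V a * (LinearMap.trace K V b - α) := by
  have hvy : LinearIndependent K ![v, α • v + β • a v] := by
    rw [LinearIndependent.pair_iff] at hv ⊢
    intro s t hst
    obtain ⟨h1, h2⟩ := hv (s + t * α) (t * β) (by rw [← hst]; module)
    have : t = 0 := by simpa [hβ] using h2
    simp_all
  obtain ⟨e, he⟩ := hw.exists_linearEquiv_apply_eq hvy
  have he0 : e w = v := he 0
  have he1 : e (b w) = α • v + β • a v := he 1
  have hev : e.symm v = w := by rw [← he0, LinearEquiv.symm_apply_apply]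
  refine ⟨e, ?_⟩
  rw [LinearMap.trace_mul_of_finrank_eq_two hV a (e.conj b) hv hβ
    (by rw [LinearEquiv.conj_apply_apply, hev, he1]), LinearMap.trace_conj',
    LinearEquiv.conj_apply, LinearMap.comp_assoc, LinearMap.det_conj]

end

section

variable {F : Type*} [Field F] [Fintype F]

/-- If neither `x² + t x + d` nor `x² - s x + δ` has a root, then the affine conic
`α² + t α β + d β² - s α + l β + δ = 0` has a rational point, and `β ≠ 0` there. -/
theorem FiniteField.exists_conic_point {d t s δ : F} (h₁ : ∀ x : F, x ^ 2 + t * x + d ≠ 0)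
    (h₂ : ∀ x : F, x ^ 2 - s * x + δ ≠ 0) (l : F) :
    ∃ α β : F, β ≠ 0 ∧ α ^ 2 + t * α * β + d * β ^ 2 - s * α + l * β + δ = 0 := by
  suffices ∃ α β : F, α ^ 2 + t * α * β + d * β ^ 2 - s * α + l * β + δ = 0 by
    obtain ⟨α, β, h⟩ := this
    refine ⟨α, β, ?_, h⟩
    rintro rfl
    exact h₂ α (by linear_combination h)
  by_cases hF : ringChar F = 2
  · have ht : t ≠ 0 := by
      rintro rfl
      obtain ⟨r, hr⟩ := FiniteField.isSquare_of_char_two hF (-d)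
      exact h₁ r (by linear_combination -hr)
    obtain ⟨r, hr⟩ := FiniteField.isSquare_of_char_two hF (-(d * (s / t) ^ 2 + l * (s / t) + δ))
    refine ⟨r, s / t, ?_⟩
    have : t * (s / t) = s := mul_div_cancel₀ s ht
    linear_combination -hr + r * this
  · have h2 : (2 : F) ≠ 0 := Ring.two_ne_zero hF
    have hD : t ^ 2 - 4 * d ≠ 0 := by
      intro h
      refine h₁ (-t / 2) ?_
      field_simp
      linear_combination -h
    obtain ⟨y, β, h⟩ := FiniteField.exists_root_sum_quadratic (R := F) (f := Polynomial.X ^ 2)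
      (g := Polynomial.C (-(t ^ 2 - 4 * d)) * Polynomial.X ^ 2
        + Polynomial.C (2 * t * s + 4 * l) * Polynomial.X + Polynomial.C (4 * δ - s ^ 2))
      (Polynomial.degree_X_pow 2) (Polynomial.degree_quadratic (neg_ne_zero.2 hD))
      (FiniteField.odd_card_of_char_ne_two hF)
    simp only [Polynomial.eval_add, Polynomial.eval_mul, Polynomial.eval_pow, Polynomial.eval_C,
      Polynomial.eval_X] at h
    refine ⟨(y - t * β + s) / 2, β, ?_⟩
    field_simp
    linear_combination h

theorem FiniteField.card_sub_one_le_ncard_of_injective {g : F → F} (hg : Function.Injective g)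
    {S : Set F} (h : ∀ β ≠ 0, g β ∈ S) : Fintype.card F - 1 ≤ S.ncard := by
  have hc : ({0}ᶜ : Set F).ncard = Fintype.card F - 1 := by
    rw [Set.ncard_compl, Set.ncard_singleton, Nat.card_eq_fintype_card]
  rw [← hc]
  exact Set.ncard_le_ncard_of_injOn g h hg.injOn

theorem FiniteField.card_sub_one_le_ncard_of_forall_mem {d δ : F} (hd : d ≠ 0) (hδ : δ ≠ 0)
    (t s : F) {S : Set F}
    (h : ∀ α β : F, β ≠ 0 → -d * β + (α * (s - α) - δ) / β + t * (s - α) ∈ S) :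
    Fintype.card F - 1 ≤ S.ncard := by
  by_cases h₁ : ∃ x : F, x ^ 2 + t * x + d = 0
  · obtain ⟨x, hx⟩ := h₁
    refine card_sub_one_le_ncard_of_injective (g := fun β => (x + t) * s - δ * β⁻¹)
      (fun β γ hβγ => ?_) fun β hβ => ?_
    · simpa [hδ] using hβγ
    · convert h (x * β) β hβ using 1
      field_simp
      linear_combination β ^ 2 * hx
  by_cases h₂ : ∃ x : F, x ^ 2 - s * x + δ = 0
  · obtain ⟨x, hx⟩ := h₂
    refine card_sub_one_le_ncard_of_injective (g := fun β => -d * β + t * (s - x))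
      (fun β γ hβγ => ?_) fun β hβ => ?_
    · simpa [hd] using hβγ
    · convert h x β hβ using 1
      field_simp
      linear_combination hx
  push Not at h₁ h₂
  refine card_sub_one_le_ncard_of_injective (g := id) Function.injective_id fun τ _ => ?_
  obtain ⟨α, β, hβ, hαβ⟩ := exists_conic_point h₁ h₂ (τ - t * s)
  convert h α β hβ using 1
  simp only [id]
  field_simp
  linear_combination hαβ

end

section

variable {F : Type*} [Field F] {n : ℕ}

theorem Matrix.exists_linearIndependent_pair_of_forall_ne_smul_one (A : Matrix (Fin n) (Fin n) F)
    (hA : ¬∃ c : F, A = c • (1 : Matrix (Fin n) (Fin n) F)) :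
    ∃ v, LinearIndependent F ![v, Matrix.toLin' A v] := by
  by_contra! h
  obtain ⟨c, hc⟩ := LinearMap.exists_eq_smul_id_of_forall_notLinearIndependent h
  refine hA ⟨c, Matrix.toLin'.injective ?_⟩
  rw [hc, map_smul, Matrix.toLin'_one]
  rfl

theorem Matrix.GeneralLinearGroup.ncard_trace_le_ncard_conjClasses [Finite F]
    (A B : Matrix.GeneralLinearGroup (Fin n) F) :
    {τ | ∃ e : (Fin n → F) ≃ₗ[F] (Fin n → F), LinearMap.trace F (Fin n → F)
      (Matrix.toLin' A.1 * e.conj (Matrix.toLin' B.1)) = τ}.ncard ≤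
    (ConjClasses.mk '' ({X | IsConj A X} * {X | IsConj B X})).ncard := by
  have key : ∀ τ ∈ {τ | ∃ e : (Fin n → F) ≃ₗ[F] (Fin n → F), LinearMap.trace F (Fin n → F)
      (Matrix.toLin' A.1 * e.conj (Matrix.toLin' B.1)) = τ},
      ∃ X ∈ {X | IsConj A X} * {X | IsConj B X}, X.1.trace = τ := by
    rintro _ ⟨e, rfl⟩
    let g := Matrix.GeneralLinearGroup.toLin.symm (LinearMap.GeneralLinearGroup.ofLinearEquiv e)
    have hg : Matrix.toLin' g.1 = e := by
      have : Matrix.GeneralLinearGroup.toLin g = LinearMap.GeneralLinearGroup.ofLinearEquiv e :=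
        MulEquiv.apply_symm_apply _ _
      exact congrArg Units.val this
    have hg' : Matrix.toLin' (g⁻¹).1 = e.symm := by
      have : Matrix.GeneralLinearGroup.toLin g⁻¹ =
          (LinearMap.GeneralLinearGroup.ofLinearEquiv e)⁻¹ := by
        rw [map_inv]; exact congrArg _ (MulEquiv.apply_symm_apply _ _)
      exact congrArg Units.val this
    refine ⟨A * (g * B * g⁻¹), Set.mul_mem_mul (IsConj.refl A) (isConj_iff.2 ⟨g, rfl⟩), ?_⟩
    rw [← Matrix.trace_toLin'_eq, Units.val_mul, Units.val_mul, Units.val_mul, Matrix.toLin'_mul,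
      Matrix.toLin'_mul, Matrix.toLin'_mul, hg, hg']
    rfl
  choose! X hX hXτ using key
  refine Set.ncard_le_ncard_of_injOn (fun τ => ConjClasses.mk (X τ))
    (fun τ hτ => ⟨_, hX τ hτ, rfl⟩) ?_ (Set.toFinite _)
  intro τ hτ σ hσ h
  obtain ⟨g, hg⟩ := isConj_iff.1 (ConjClasses.mk_eq_mk_iff_isConj.1 h)
  rw [← hXτ τ hτ, ← hXτ σ hσ, ← hg, Units.val_mul, Units.val_mul, Matrix.trace_units_conj]

theorem Matrix.GeneralLinearGroup.mem_center_of_eq_smul_one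
    {A : Matrix.GeneralLinearGroup (Fin n) F} {c : F}
    (hA : (A : Matrix (Fin n) (Fin n) F) = c • (1 : Matrix (Fin n) (Fin n) F)) :
    A ∈ Subgroup.center (Matrix.GeneralLinearGroup (Fin n) F) := by
  refine Subgroup.mem_center_iff.2 fun g => Units.ext ?_
  simp [hA]

end

theorem setOf_isConj_mul_of_mem_center {G : Type*} [Group G] {a : G} (b : G)
    (ha : a ∈ Subgroup.center G) :
    {x | IsConj a x} * {x | IsConj b x} = {x | IsConj (a * b) x} := by
  have ha' := Subgroup.mem_center_iff.1 ha
  ext x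
  simp only [Set.mem_mul, Set.mem_ofPred_eq, isConj_iff]
  constructor
  · rintro ⟨_, ⟨g, rfl⟩, _, ⟨h, rfl⟩, rfl⟩
    exact ⟨h, by simp [ha', ← mul_assoc]⟩
  · rintro ⟨g, rfl⟩
    exact ⟨a, ⟨1, by simp⟩, _, ⟨g, rfl⟩, by simp [ha', ← mul_assoc]⟩

theorem setOf_isConj_mul_of_mem_center_right {G : Type*} [Group G] (a : G) {b : G}
    (hb : b ∈ Subgroup.center G) :
    {x | IsConj a x} * {x | IsConj b x} = {x | IsConj (a * b) x} := by
  have hb' := Subgroup.mem_center_iff.1 hb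
  have hbc {y : G} : IsConj b y ↔ y = b := by
    rw [isConj_iff]
    simp [hb', eq_comm]
  ext x
  simp only [Set.mem_mul, Set.mem_ofPred_eq, hbc, exists_eq_left, isConj_iff]
  constructor
  · rintro ⟨_, ⟨g, rfl⟩, rfl⟩
    exact ⟨g, by simp only [mul_assoc, hb' g⁻¹]⟩
  · rintro ⟨g, rfl⟩
    exact ⟨_, ⟨g, rfl⟩, by simp only [mul_assoc, hb' g⁻¹]⟩

theorem stmt_13 (F : Type*) [Field F] [Fintype F] (n : ℕ) (hn : 2 ≤ n)
    (A B : Matrix.GeneralLinearGroup (Fin n) F) :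
    (((∃ lam : F, (A : Matrix (Fin n) (Fin n) F) = lam • (1 : Matrix (Fin n) (Fin n) F)) ∨
        (∃ lam : F, (B : Matrix (Fin n) (Fin n) F) = lam • (1 : Matrix (Fin n) (Fin n) F))) ∧
      {X | IsConj A X} * {X | IsConj B X} = {X | IsConj (A * B) X}) ∨
    Fintype.card F - 1 ≤ Set.ncard
      (ConjClasses.mk '' ({X | IsConj A X} * {X | IsConj B X})) := by
  by_cases hA : ∃ lam : F, (A : Matrix (Fin n) (Fin n) F) = lam • (1 : Matrix (Fin n) (Fin n) F)
  · exact .inl ⟨.inl hA, setOf_isConj_mul_of_mem_center B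
      (Matrix.GeneralLinearGroup.mem_center_of_eq_smul_one hA.choose_spec)⟩
  by_cases hB : ∃ lam : F, (B : Matrix (Fin n) (Fin n) F) = lam • (1 : Matrix (Fin n) (Fin n) F)
  · exact .inl ⟨.inr hB, setOf_isConj_mul_of_mem_center_right A
      (Matrix.GeneralLinearGroup.mem_center_of_eq_smul_one hB.choose_spec)⟩
  refine .inr (le_trans ?_ (Matrix.GeneralLinearGroup.ncard_trace_le_ncard_conjClasses A B))
  obtain ⟨v, hv⟩ := Matrix.exists_linearIndependent_pair_of_forall_ne_smul_one A.1 hA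
  obtain ⟨w, hw⟩ := Matrix.exists_linearIndependent_pair_of_forall_ne_smul_one B.1 hB
  rcases hn.eq_or_lt with rfl | hn
  · refine FiniteField.card_sub_one_le_ncard_of_forall_mem (d := LinearMap.det (Matrix.toLin' A.1))
      (δ := LinearMap.det (Matrix.toLin' B.1)) ?_ ?_ _ _ fun α β hβ =>
      exists_conj_trace_mul_eq_of_finrank_eq_two (by simp) _ _ hv hw α hβ
    · rw [LinearMap.det_toLin']
      exact A.det_ne_zero
    · rw [LinearMap.det_toLin']
      exact B.det_ne_zero
  · exact FiniteField.card_sub_one_le_ncard_of_injective Function.injective_id fun τ _ =>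
      exists_conj_trace_mul_eq_of_three_le_finrank (by simpa using Nat.succ_le_of_lt hn) _ _ hv hw τ
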